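/- arXiv:1805.11635 — 2 statements merged into one kernel-verified Lean document; each statement's English description precedes it below -/
import Mathlib

section
/- Let A be a complex Banach algebra, (S, ‖·‖_S) a left introverted homogeneous subspace of A*, and let E denote the closure of S in A* with respect to ‖·‖_{A*}. Then E, equipped with the norm ‖·‖_{A*}, is itself a left introverted homogeneous subspace of A*: E is a norm-closed right A-submodule of A* (φ·a ∈ E for φ ∈ E, a ∈ A), and for every μ ∈ E* and φ ∈ E the functional μ◻φ (defined by ⟨μ◻φ, a⟩ = ⟨μ, φ·a⟩) belongs to E with ‖μ◻φ‖_{A*} ≤ ‖μ‖‖φ‖_{A*}. Moreover the identity embedding (S, ‖·‖_S) → (E, ‖·‖_{A*}) is a contraction. -/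
open scoped Topology
open Filter

noncomputable section

/-- The right dual action of `A` on `A*`: `(φ · a) b = φ (a * b)`. -/
def dAct {A : Type*} [NonUnitalNormedRing A] [NormedSpace ℂ A]
    [IsScalarTower ℂ A A] [SMulCommClass ℂ A A]
    (φ : A →L[ℂ] ℂ) (a : A) : A →L[ℂ] ℂ :=
  φ.comp (ContinuousLinearMap.mul ℂ A a)

/-- Let `(S, ‖·‖_S)` be a left introverted homogeneous subspace of `A*`
(realized by the embedding `ι` with module action `act` and introversion `box`), and let
`E` be the `‖·‖_{A*}`-closure of `S` in `A*`.  Then `E` with the norm of `A*` is a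
norm-closed left introverted subspace of `A*`: it is a closed linear subspace, a right
`A`-submodule on which the action is contractive, for every bounded linear functional
`μ` on `(E, ‖·‖_{A*})` (given as a function with bound `C`) and every `φ ∈ E` the
functional `μ ◻ φ : a ↦ μ(φ·a)` again lies in `E` with `‖μ ◻ φ‖ ≤ C‖φ‖`, and the
identity embedding `(S, ‖·‖_S) → (E, ‖·‖_{A*})` is a contraction. -/
theorem statement_1
    {A : Type*} [NonUnitalNormedRing A] [NormedSpace ℂ A] [CompleteSpace A]
    [IsScalarTower ℂ A A] [SMulCommClass ℂ A A]
    {S : Type*} [NormedAddCommGroup S] [NormedSpace ℂ S] [CompleteSpace S]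
    (ι : S →ₗ[ℂ] (A →L[ℂ] ℂ)) (hinj : Function.Injective ι)
    (hι : ∀ φ : S, ‖ι φ‖ ≤ ‖φ‖)
    (act : S → A → S)
    (hact : ∀ (φ : S) (a : A), ι (act φ a) = dAct (ι φ) a)
    (hactnorm : ∀ (φ : S) (a : A), ‖act φ a‖ ≤ ‖φ‖ * ‖a‖)
    (box : (S →L[ℂ] ℂ) → S → S)
    (hbox : ∀ (μ : S →L[ℂ] ℂ) (φ : S) (a : A), ι (box μ φ) a = μ (act φ a))
    (hboxnorm : ∀ (μ : S →L[ℂ] ℂ) (φ : S), ‖box μ φ‖ ≤ ‖μ‖ * ‖φ‖)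
    (E : Set (A →L[ℂ] ℂ)) (hE : E = closure (Set.range ι)) :
    IsClosed E ∧
    (0 : A →L[ℂ] ℂ) ∈ E ∧
    (∀ φ ψ, φ ∈ E → ψ ∈ E → φ + ψ ∈ E) ∧
    (∀ (c : ℂ) φ, φ ∈ E → c • φ ∈ E) ∧
    (∀ φ, φ ∈ E → ∀ a : A, dAct φ a ∈ E) ∧
    (∀ (φ : A →L[ℂ] ℂ) (a : A), ‖dAct φ a‖ ≤ ‖φ‖ * ‖a‖) ∧
    (∀ (μ : (A →L[ℂ] ℂ) → ℂ) (C : ℝ), 0 ≤ C →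
      (∀ φ ψ, φ ∈ E → ψ ∈ E → μ (φ + ψ) = μ φ + μ ψ) →
      (∀ (c : ℂ) φ, φ ∈ E → μ (c • φ) = c * μ φ) →
      (∀ φ, φ ∈ E → ‖μ φ‖ ≤ C * ‖φ‖) →
      ∀ φ, φ ∈ E → ∃ ψ : A →L[ℂ] ℂ, ψ ∈ E ∧
        (∀ a : A, ψ a = μ (dAct φ a)) ∧ ‖ψ‖ ≤ C * ‖φ‖) ∧
    (∀ φ : S, ι φ ∈ E ∧ ‖ι φ‖ ≤ ‖φ‖) := by
  have dnorm : ∀ (φ : A →L[ℂ] ℂ) (a : A), ‖dAct φ a‖ ≤ ‖φ‖ * ‖a‖ := by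
    intro φ a
    refine (ContinuousLinearMap.opNorm_comp_le _ _).trans ?_
    exact mul_le_mul_of_nonneg_left (ContinuousLinearMap.opNorm_mul_apply_le ℂ A a)
      (norm_nonneg _)
  have dadd : ∀ (φ : A →L[ℂ] ℂ) (a b : A), dAct φ (a + b) = dAct φ a + dAct φ b := by
    intro φ a b
    ext x
    simp [dAct, add_mul]
  have dsmul : ∀ (φ : A →L[ℂ] ℂ) (c : ℂ) (a : A), dAct φ (c • a) = c • dAct φ a := by
    intro φ c a
    ext x
    simp [dAct]
  have dsub : ∀ (φ ψ : A →L[ℂ] ℂ) (a : A), dAct φ a = dAct (φ - ψ) a + dAct ψ a := by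
    intro φ ψ a
    ext x
    simp [dAct]
  have hEP : E = ((LinearMap.range ι).topologicalClosure : Set (A →L[ℂ] ℂ)) := by
    rw [hE, Submodule.topologicalClosure_coe, LinearMap.coe_range]
  have hmemP : ∀ φ, φ ∈ E ↔ φ ∈ (LinearMap.range ι).topologicalClosure := by
    intro φ
    rw [hEP]; rfl
  have hιE : ∀ s, ι s ∈ E := fun s => hE ▸ subset_closure ⟨s, rfl⟩
  have hEadd : ∀ φ ψ, φ ∈ E → ψ ∈ E → φ + ψ ∈ E := by
    intro φ ψ h1 h2
    rw [hmemP] at *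
    exact add_mem h1 h2
  have hEsmul : ∀ (c : ℂ) φ, φ ∈ E → c • φ ∈ E := by
    intro c φ h1
    rw [hmemP] at *
    exact Submodule.smul_mem _ c h1
  have hEsub : ∀ φ ψ, φ ∈ E → ψ ∈ E → φ - ψ ∈ E := by
    intro φ ψ h1 h2
    rw [hmemP] at *
    exact sub_mem h1 h2
  have hEact : ∀ φ, φ ∈ E → ∀ a : A, dAct φ a ∈ E := by
    intro φ h a
    have hc : Continuous (fun φ : A →L[ℂ] ℂ => dAct φ a) := by
      unfold dAct
      fun_prop
    rw [hE] at h ⊢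
    refine map_mem_closure (f := fun φ : A →L[ℂ] ℂ => dAct φ a) hc h ?_
    rintro _ ⟨s, rfl⟩
    exact ⟨act s a, hact s a⟩
  refine ⟨hE ▸ isClosed_closure, ?_, hEadd, hEsmul, hEact, dnorm, ?_, fun s => ⟨hιE s, hι s⟩⟩
  · rw [hmemP]; exact zero_mem _
  intro μ C hC madd msmul mbd φ hφ
  have bd : ∀ χ, χ ∈ E → ∀ a, ‖μ (dAct χ a)‖ ≤ C * ‖χ‖ * ‖a‖ := by
    intro χ hχ a
    refine (mbd _ (hEact χ hχ a)).trans ?_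
    rw [mul_assoc]
    exact mul_le_mul_of_nonneg_left (dnorm χ a) hC
  let l : A →ₗ[ℂ] ℂ :=
    { toFun := fun a => μ (dAct φ a)
      map_add' := fun a b => by
        rw [dadd, madd _ _ (hEact φ hφ a) (hEact φ hφ b)]
      map_smul' := fun c a => by
        rw [dsmul, msmul _ _ (hEact φ hφ a)]; rfl }
  let ψ : A →L[ℂ] ℂ := l.mkContinuous (C * ‖φ‖) (bd φ hφ)
  have hψ : ∀ a, ψ a = μ (dAct φ a) := fun a => rfl
  let m : S →ₗ[ℂ] ℂ :=
    { toFun := fun s => μ (ι s)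
      map_add' := fun a b => by
        rw [map_add, madd _ _ (hιE a) (hιE b)]
      map_smul' := fun c a => by
        rw [map_smul, msmul _ _ (hιE a)]; rfl }
  let ν : S →L[ℂ] ℂ := m.mkContinuous C (fun s =>
    (mbd _ (hιE s)).trans (mul_le_mul_of_nonneg_left (hι s) hC))
  have hν : ∀ s, ν s = μ (ι s) := fun s => rfl
  refine ⟨ψ, ?_, hψ, l.mkContinuous_norm_le (by positivity) _⟩
  rw [hE, Metric.mem_closure_iff]
  intro ε hε
  have hφ' := hφ
  rw [hE, Metric.mem_closure_iff] at hφ'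
  obtain ⟨_, ⟨s, rfl⟩, hs⟩ := hφ' (ε / (C + 1)) (by positivity)
  refine ⟨ι (box ν s), ⟨_, rfl⟩, ?_⟩
  rw [dist_eq_norm] at hs ⊢
  have hle : ‖ψ - ι (box ν s)‖ ≤ C * ‖φ - ι s‖ := by
    refine ContinuousLinearMap.opNorm_le_bound _ (by positivity) fun a => ?_
    have hd := hEsub _ _ hφ (hιE s)
    have : (ψ - ι (box ν s)) a = μ (dAct (φ - ι s) a) := by
      rw [ContinuousLinearMap.sub_apply, hbox, hν, hψ, hact, dsub φ (ι s) a,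
        madd _ _ (hEact _ hd a) (hEact _ (hιE s) a)]
      ring
    rw [this]
    exact bd _ hd a
  rw [lt_div_iff₀ (by positivity)] at hs
  nlinarith [norm_nonneg (φ - ι s)]


end
end

section
/- Let A be a complex Banach algebra and X a contractive right Banach A-module. Then (F_q(A*), ‖·‖_q) is a left introverted homogeneous subspace of A*: ‖·‖_q is a complete norm on F_q(A*); ‖φ‖_{A*} ≤ ‖φ‖_q for all φ ∈ F_q(A*); φ·a ∈ F_q(A*) with ‖φ·a‖_q ≤ ‖φ‖_q‖a‖ for all φ ∈ F_q(A*), a ∈ A; and for every μ ∈ F_q(A*)* and φ ∈ F_q(A*), the functional μ◻φ belongs to F_q(A*) with ‖μ◻φ‖_q ≤ ‖μ‖‖φ‖_q. Moreover, whenever (x_n*) in X* and (x_n) in X satisfy Σ_n ‖x_n*‖‖x_n‖ < ∞, the series Σ_n x_n*·x_n converges in the norm ‖·‖_q (and hence also in ‖·‖_{A*}) to an element of F_q(A*), and this norm sum coincides with the σ(A*, A)-sum. -/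
open scoped Topology
open Filter

noncomputable section

/-- coefficient functional `x* · x` of a module action: `(x* · x) a = x* (x · a)`. -/
def coeffFn {A : Type*} [NonUnitalNormedRing A] [NormedSpace ℂ A]
    [IsScalarTower ℂ A A] [SMulCommClass ℂ A A]
    {X : Type*} [NormedAddCommGroup X] [NormedSpace ℂ X]
    (m : X →L[ℂ] A →L[ℂ] X) (xs : X →L[ℂ] ℂ) (x : X) : A →L[ℂ] ℂ :=
  xs.comp (m x)

/-- Membership in the Fourier space `F_q(A*)`. -/
def FqMem {A : Type*} [NonUnitalNormedRing A] [NormedSpace ℂ A]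
    [IsScalarTower ℂ A A] [SMulCommClass ℂ A A]
    {X : Type*} [NormedAddCommGroup X] [NormedSpace ℂ X]
    (m : X →L[ℂ] A →L[ℂ] X) (φ : A →L[ℂ] ℂ) : Prop :=
  ∃ (xs : ℕ → (X →L[ℂ] ℂ)) (x : ℕ → X),
    (Summable fun n => ‖xs n‖ * ‖x n‖) ∧
    ∀ a : A, HasSum (fun n => xs n (m (x n) a)) (φ a)

/-- The Fourier norm `‖·‖_q`. -/
def qNorm {A : Type*} [NonUnitalNormedRing A] [NormedSpace ℂ A]
    [IsScalarTower ℂ A A] [SMulCommClass ℂ A A]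
    {X : Type*} [NormedAddCommGroup X] [NormedSpace ℂ X]
    (m : X →L[ℂ] A →L[ℂ] X) (φ : A →L[ℂ] ℂ) : ℝ :=
  sInf { c : ℝ | ∃ (xs : ℕ → (X →L[ℂ] ℂ)) (x : ℕ → X),
    (Summable fun n => ‖xs n‖ * ‖x n‖) ∧
    (∀ a : A, HasSum (fun n => xs n (m (x n) a)) (φ a)) ∧
    c = ∑' n, ‖xs n‖ * ‖x n‖ }

section helpers

set_option linter.unusedSectionVars false

variable {A : Type*} [NonUnitalNormedRing A] [NormedSpace ℂ A]
    [IsScalarTower ℂ A A] [SMulCommClass ℂ A A]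
    {X : Type*} [NormedAddCommGroup X] [NormedSpace ℂ X]

def FRep (m : X →L[ℂ] A →L[ℂ] X) (φ : A →L[ℂ] ℂ) (c : ℝ) : Prop :=
  ∃ (xs : ℕ → (X →L[ℂ] ℂ)) (x : ℕ → X),
    (Summable fun n => ‖xs n‖ * ‖x n‖) ∧
    (∀ a : A, HasSum (fun n => xs n (m (x n) a)) (φ a)) ∧
    ∑' n, ‖xs n‖ * ‖x n‖ ≤ c

theorem FRep.mem {m : X →L[ℂ] A →L[ℂ] X} {φ : A →L[ℂ] ℂ} {c : ℝ} (h : FRep m φ c) :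
    FqMem m φ := by
  obtain ⟨xs, x, h1, h2, -⟩ := h
  exact ⟨xs, x, h1, h2⟩

theorem FRep.nonneg {m : X →L[ℂ] A →L[ℂ] X} {φ : A →L[ℂ] ℂ} {c : ℝ} (h : FRep m φ c) :
    0 ≤ c := by
  obtain ⟨xs, x, h1, h2, h3⟩ := h
  exact le_trans (tsum_nonneg fun n => by positivity) h3

theorem FRep.qNorm_le {m : X →L[ℂ] A →L[ℂ] X} {φ : A →L[ℂ] ℂ} {c : ℝ} (h : FRep m φ c) :
    qNorm m φ ≤ c := by
  obtain ⟨xs, x, h1, h2, h3⟩ := h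
  refine le_trans (csInf_le ⟨0, ?_⟩ ⟨xs, x, h1, h2, rfl⟩) h3
  rintro _ ⟨xs, x, -, -, rfl⟩
  exact tsum_nonneg fun n => by positivity

theorem qNorm_nonneg' (m : X →L[ℂ] A →L[ℂ] X) (φ : A →L[ℂ] ℂ) : 0 ≤ qNorm m φ := by
  apply Real.sInf_nonneg
  rintro _ ⟨xs, x, -, -, rfl⟩
  exact tsum_nonneg fun n => by positivity

theorem FqMem.rep {m : X →L[ℂ] A →L[ℂ] X} {φ : A →L[ℂ] ℂ} {c : ℝ} (h : FqMem m φ)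
    (hc : qNorm m φ < c) : FRep m φ c := by
  obtain ⟨xs, x, h1, h2⟩ := h
  unfold qNorm at hc
  obtain ⟨_, ⟨xs, x, h1, h2, rfl⟩, h4⟩ := exists_lt_of_csInf_lt (by exact ⟨_, xs, x, h1, h2, rfl⟩) hc
  exact ⟨xs, x, h1, h2, h4.le⟩

theorem FRep.of_index {ι : Type} [Denumerable ι] {m : X →L[ℂ] A →L[ℂ] X} {φ : A →L[ℂ] ℂ}
    {c : ℝ} (xs : ι → (X →L[ℂ] ℂ)) (x : ι → X)
    (h1 : Summable fun n => ‖xs n‖ * ‖x n‖)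
    (h2 : ∀ a : A, HasSum (fun n => xs n (m (x n) a)) (φ a))
    (h3 : ∑' n, ‖xs n‖ * ‖x n‖ ≤ c) : FRep m φ c := by
  let e := (Denumerable.eqv ι).symm
  refine ⟨xs ∘ e, x ∘ e, ?_, ?_, ?_⟩
  · exact (e.summable_iff (f := fun n => ‖xs n‖ * ‖x n‖)).2 h1
  · intro a
    exact (e.hasSum_iff (f := fun n => xs n (m (x n) a))).2 (h2 a)
  · exact le_trans (e.tsum_eq (fun n => ‖xs n‖ * ‖x n‖)).le h3

theorem term_bound {m : X →L[ℂ] A →L[ℂ] X} (hmn : ∀ (x : X) (a : A), ‖m x a‖ ≤ ‖x‖ * ‖a‖)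
    (f : X →L[ℂ] ℂ) (x : X) (a : A) : ‖f (m x a)‖ ≤ ‖f‖ * ‖x‖ * ‖a‖ := by
  calc _ ≤ ‖f‖ * ‖m x a‖ := f.le_opNorm _
    _ ≤ ‖f‖ * (‖x‖ * ‖a‖) := by gcongr; exact hmn x a
    _ = _ := by ring

theorem FRep.norm_le {m : X →L[ℂ] A →L[ℂ] X} (hmn : ∀ (x : X) (a : A), ‖m x a‖ ≤ ‖x‖ * ‖a‖)
    {φ : A →L[ℂ] ℂ} {c : ℝ} (h : FRep m φ c) : ‖φ‖ ≤ c := by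
  have hc := h.nonneg
  obtain ⟨xs, x, h1, h2, h3⟩ := h
  refine φ.opNorm_le_bound hc fun a => ?_
  rw [← (h2 a).tsum_eq]
  refine le_trans (tsum_of_norm_bounded (h1.mul_right ‖a‖).hasSum
    fun n => term_bound hmn (xs n) (x n) a) ?_
  rw [tsum_mul_right]
  gcongr

theorem FRep.zero (m : X →L[ℂ] A →L[ℂ] X) : FRep m 0 0 :=
  ⟨0, 0, by simpa using summable_zero, fun a => by simpa using hasSum_zero, by simp⟩

theorem FRep.single (m : X →L[ℂ] A →L[ℂ] X) (f : X →L[ℂ] ℂ) (x : X) :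
    FRep m (coeffFn m f x) (‖f‖ * ‖x‖) := by
  have h : HasSum (fun n : ℕ => ‖(Pi.single 0 f : ℕ → (X →L[ℂ] ℂ)) n‖ * ‖x‖) (‖f‖ * ‖x‖) := by
    convert hasSum_single (f := fun n : ℕ => ‖(Pi.single 0 f : ℕ → (X →L[ℂ] ℂ)) n‖ * ‖x‖) 0 ?_
      using 1
    · simp
    · intro n hn
      simp [hn]
  refine ⟨Pi.single 0 f, fun _ => x, h.summable, fun a => ?_, h.tsum_eq.le⟩
  convert hasSum_single (f := fun n : ℕ => (Pi.single 0 f : ℕ → (X →L[ℂ] ℂ)) n (m x a)) 0 ?_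
    using 1
  · simp [coeffFn]
  · intro n hn
    simp [hn]

theorem FRep.smul {m : X →L[ℂ] A →L[ℂ] X} {φ : A →L[ℂ] ℂ} {c : ℝ} (h : FRep m φ c) (z : ℂ) :
    FRep m (z • φ) (‖z‖ * c) := by
  obtain ⟨xs, x, h1, h2, h3⟩ := h
  refine ⟨fun n => z • xs n, x, ?_, fun a => ?_, ?_⟩
  · simpa [norm_smul, mul_assoc] using h1.mul_left ‖z‖
  · simpa using (h2 a).mul_left z
  · simp only [norm_smul, mul_assoc, tsum_mul_left]
    gcongr

theorem FRep.dAct {m : X →L[ℂ] A →L[ℂ] X} (hmn : ∀ (x : X) (a : A), ‖m x a‖ ≤ ‖x‖ * ‖a‖)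
    (hma : ∀ (x : X) (a b : A), m (m x a) b = m x (a * b))
    {φ : A →L[ℂ] ℂ} {c : ℝ} (h : FRep m φ c) (a : A) :
    FRep m (dAct φ a) (c * ‖a‖) := by
  obtain ⟨xs, x, h1, h2, h3⟩ := h
  have hb : ∀ n, ‖xs n‖ * ‖m (x n) a‖ ≤ ‖xs n‖ * ‖x n‖ * ‖a‖ := fun n => by
    rw [mul_assoc]; gcongr; exact hmn _ _
  have hs : Summable fun n => ‖xs n‖ * ‖m (x n) a‖ :=
    Summable.of_nonneg_of_le (fun n => by positivity) hb (h1.mul_right ‖a‖)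
  refine ⟨xs, fun n => m (x n) a, hs, fun b => ?_, ?_⟩
  · simpa [hma, _root_.dAct] using h2 (a * b)
  · refine le_trans (hs.tsum_le_tsum hb (h1.mul_right ‖a‖)) ?_
    rw [tsum_mul_right]
    gcongr

theorem FRep.hasSum {m : X →L[ℂ] A →L[ℂ] X} (hmn : ∀ (x : X) (a : A), ‖m x a‖ ≤ ‖x‖ * ‖a‖)
    {φ : ℕ → A →L[ℂ] ℂ} {c : ℕ → ℝ} (h : ∀ n, FRep m (φ n) (c n)) (hc : Summable c)
    {ψ : A →L[ℂ] ℂ} (hψ : ∀ a, HasSum (fun n => φ n a) (ψ a)) : FRep m ψ (∑' n, c n) := by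
  have h0 := fun n => (h n).nonneg
  choose xs x h1 h2 h3 using h
  have hs : Summable fun p : ℕ × ℕ => ‖xs p.1 p.2‖ * ‖x p.1 p.2‖ := by
    rw [summable_prod_of_nonneg (fun p => by positivity)]
    exact ⟨h1, Summable.of_nonneg_of_le (fun n => tsum_nonneg fun k => by positivity) h3 hc⟩
  refine FRep.of_index (fun p : ℕ × ℕ => xs p.1 p.2) (fun p => x p.1 p.2) hs (fun a => ?_) ?_
  · have hS : Summable fun p : ℕ × ℕ => xs p.1 p.2 (m (x p.1 p.2) a) :=
      Summable.of_norm_bounded (hs.mul_right ‖a‖) fun p => term_bound hmn _ _ a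
    have := hS.hasSum.prod_fiberwise (fun n => h2 n a)
    rw [(hψ a).unique this]
    exact hS.hasSum
  · rw [hs.tsum_prod]
    exact Summable.tsum_le_tsum h3
      (Summable.of_nonneg_of_le (fun n => tsum_nonneg fun k => by positivity) h3 hc) hc

theorem FRep.add {m : X →L[ℂ] A →L[ℂ] X} (hmn : ∀ (x : X) (a : A), ‖m x a‖ ≤ ‖x‖ * ‖a‖)
    {φ ψ : A →L[ℂ] ℂ} {c d : ℝ} (h : FRep m φ c) (h' : FRep m ψ d) : FRep m (φ + ψ) (c + d) := by
  let f : ℕ → A →L[ℂ] ℂ := fun n => if n = 0 then φ else if n = 1 then ψ else 0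
  let g : ℕ → ℝ := fun n => if n = 0 then c else if n = 1 then d else 0
  have hg : HasSum g (c + d) := by
    have := hasSum_sum_of_ne_finset_zero (L := .unconditional ℕ) (f := g) (s := Finset.range 2) (by
      intro b hb
      simp at hb
      simp only [g]
      rw [if_neg (by omega), if_neg (by omega)])
    simpa [Finset.sum_range_succ, g] using this
  have hf : HasSum f (φ + ψ) := by
    have := hasSum_sum_of_ne_finset_zero (L := .unconditional ℕ) (f := f) (s := Finset.range 2) (by
      intro b hb
      simp at hb
      simp only [f]
      rw [if_neg (by omega), if_neg (by omega)])
    simpa [Finset.sum_range_succ, f] using this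
  rw [← hg.tsum_eq]
  refine FRep.hasSum hmn (φ := f) (fun n => ?_) hg.summable
    (fun a => hf.mapL (ContinuousLinearMap.apply ℂ ℂ a))
  simp only [f, g]
  split_ifs
  exacts [h, h', FRep.zero m]

theorem FRep.series {m : X →L[ℂ] A →L[ℂ] X} (hmn : ∀ (x : X) (a : A), ‖m x a‖ ≤ ‖x‖ * ‖a‖)
    {φ : ℕ → A →L[ℂ] ℂ} {c : ℕ → ℝ} (h : ∀ n, FRep m (φ n) (c n)) (hc : Summable c) :
    ∃ ψ : A →L[ℂ] ℂ, HasSum φ ψ ∧ FRep m ψ (∑' n, c n) ∧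
      ∀ N, FRep m (ψ - ∑ n ∈ Finset.range N, φ n) (∑' n, c (n + N)) := by
  have hs : Summable φ := Summable.of_norm_bounded hc fun n => (h n).norm_le hmn
  have key : ∀ N, FRep m (∑' n, φ n - ∑ n ∈ Finset.range N, φ n) (∑' n, c (n + N)) := by
    intro N
    rw [← hs.sum_add_tsum_nat_add N, add_sub_cancel_left]
    refine FRep.hasSum hmn (φ := fun n => φ (n + N)) (fun n => h _)
      ((summable_nat_add_iff N).2 hc) fun a => ?_
    exact ((summable_nat_add_iff N).2 hs).hasSum.mapL (ContinuousLinearMap.apply ℂ ℂ a)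
  exact ⟨_, hs.hasSum, by simpa using key 0, key⟩

theorem FRep.tail {m : X →L[ℂ] A →L[ℂ] X} {ψ : ℕ → A →L[ℂ] ℂ} {c : ℕ → ℝ}
    (h : ∀ N, FRep m (ψ N) (∑' n, c (n + N))) :
    Tendsto (fun N => qNorm m (ψ N)) atTop (𝓝 0) :=
  squeeze_zero (fun N => qNorm_nonneg' m _) (fun N => (h N).qNorm_le)
    (tendsto_sum_nat_add c)

theorem series_coeff {m : X →L[ℂ] A →L[ℂ] X} (hmn : ∀ (x : X) (a : A), ‖m x a‖ ≤ ‖x‖ * ‖a‖)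
    (xs : ℕ → (X →L[ℂ] ℂ)) (x : ℕ → X) (hs : Summable fun n => ‖xs n‖ * ‖x n‖) :
      ∃ φ : A →L[ℂ] ℂ, FqMem m φ ∧
        (∀ a : A, HasSum (fun n => xs n (m (x n) a)) (φ a)) ∧
        Tendsto (fun N => qNorm m (φ - ∑ n ∈ Finset.range N, coeffFn m (xs n) (x n)))
          atTop (𝓝 0) ∧
        Tendsto (fun N => ‖φ - ∑ n ∈ Finset.range N, coeffFn m (xs n) (x n)‖)
          atTop (𝓝 0) := by
  obtain ⟨ψ, h1, h2, h3⟩ := FRep.series hmn (fun n => FRep.single m (xs n) (x n)) hs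
  refine ⟨ψ, h2.mem, fun a => h1.mapL (ContinuousLinearMap.apply ℂ ℂ a), FRep.tail (c := fun n => ‖xs n‖ * ‖x n‖) h3, ?_⟩
  exact squeeze_zero (fun N => norm_nonneg _) (fun N => (h3 N).norm_le hmn)
    (tendsto_sum_nat_add fun n => ‖xs n‖ * ‖x n‖)

theorem FRep.le_of_forall {m : X →L[ℂ] A →L[ℂ] X} {φ : A →L[ℂ] ℂ} (h : FqMem m φ) {r k : ℝ}
    (hr : ∀ c, FRep m φ c → r ≤ k * c) : r ≤ k * qNorm m φ := by
  have h1 : Tendsto (fun c => k * c) (𝓝[>] qNorm m φ) (𝓝 (k * qNorm m φ)) :=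
    ((continuous_const.mul continuous_id).tendsto _).mono_left nhdsWithin_le_nhds
  refine ge_of_tendsto h1 ?_
  filter_upwards [self_mem_nhdsWithin] with c hc
  exact hr c (h.rep hc)

theorem FqMem.exists_rep {m : X →L[ℂ] A →L[ℂ] X} {φ : A →L[ℂ] ℂ} (h : FqMem m φ) :
    ∃ c, FRep m φ c := ⟨_, h.rep (lt_add_one _)⟩

theorem qNorm_add_le' {m : X →L[ℂ] A →L[ℂ] X} (hmn : ∀ (x : X) (a : A), ‖m x a‖ ≤ ‖x‖ * ‖a‖)
    {φ ψ : A →L[ℂ] ℂ} (h : FqMem m φ) (h' : FqMem m ψ) :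
    qNorm m (φ + ψ) ≤ qNorm m φ + qNorm m ψ := by
  refine le_of_forall_pos_le_add fun ε hε => ?_
  have := ((h.rep (lt_add_of_pos_right _ (half_pos hε))).add hmn
    (h'.rep (lt_add_of_pos_right _ (half_pos hε)))).qNorm_le
  linarith

theorem qNorm_smul_le' {m : X →L[ℂ] A →L[ℂ] X} (z : ℂ)
    {φ : A →L[ℂ] ℂ} (h : FqMem m φ) :
    qNorm m (z • φ) ≤ ‖z‖ * qNorm m φ :=
  FRep.le_of_forall h fun _ hc => (hc.smul z).qNorm_le

theorem FqMem.smul' {m : X →L[ℂ] A →L[ℂ] X} (z : ℂ)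
    {φ : A →L[ℂ] ℂ} (h : FqMem m φ) : FqMem m (z • φ) := by
  obtain ⟨c, hc⟩ := h.exists_rep
  exact (hc.smul z).mem

theorem FqMem.add' {m : X →L[ℂ] A →L[ℂ] X} (hmn : ∀ (x : X) (a : A), ‖m x a‖ ≤ ‖x‖ * ‖a‖)
    {φ ψ : A →L[ℂ] ℂ} (h : FqMem m φ) (h' : FqMem m ψ) : FqMem m (φ + ψ) := by
  obtain ⟨c, hc⟩ := h.exists_rep
  obtain ⟨d, hd⟩ := h'.exists_rep
  exact (hc.add hmn hd).mem

theorem FqMem.sub' {m : X →L[ℂ] A →L[ℂ] X} (hmn : ∀ (x : X) (a : A), ‖m x a‖ ≤ ‖x‖ * ‖a‖)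
    {φ ψ : A →L[ℂ] ℂ} (h : FqMem m φ) (h' : FqMem m ψ) : FqMem m (φ - ψ) := by
  have := h.add' hmn (h'.smul' (-1 : ℂ))
  rwa [neg_one_smul ℂ ψ, ← sub_eq_add_neg] at this

theorem complete' {m : X →L[ℂ] A →L[ℂ] X} (hmn : ∀ (x : X) (a : A), ‖m x a‖ ≤ ‖x‖ * ‖a‖)
    (u : ℕ → (A →L[ℂ] ℂ)) (hu : ∀ n, FqMem m (u n))
    (hC : ∀ ε : ℝ, 0 < ε → ∃ N : ℕ, ∀ k l : ℕ, N ≤ k → N ≤ l → qNorm m (u k - u l) < ε) :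
      ∃ φ, FqMem m φ ∧ Tendsto (fun n => qNorm m (u n - φ)) atTop (𝓝 0) := by
  choose N hN using fun k : ℕ => hC ((1 / 2) ^ k) (by positivity)
  let M : ℕ → ℕ := fun k => ∑ i ∈ Finset.range (k + 1), N i
  have hNM : ∀ k, N k ≤ M k := fun k => by
    simp [M, Finset.sum_range_succ]
  have hMM : ∀ k, M k ≤ M (k + 1) := fun k => by
    simp only [M]
    rw [Finset.sum_range_succ _ (k + 1)]
    omega
  have hrep : ∀ k, FRep m (u (M (k + 1)) - u (M k)) ((1 / 2) ^ k) := fun k =>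
    ((hu _).sub' hmn (hu _)).rep (hN k _ _ ((hNM k).trans (hMM k)) (hNM k))
  obtain ⟨ψ, -, h2, h3⟩ := FRep.series hmn hrep summable_geometric_two
  have hφ : FqMem m (u (M 0) + ψ) := (hu _).add' hmn h2.mem
  refine ⟨u (M 0) + ψ, hφ, ?_⟩
  have ht := FRep.tail h3
  rw [Metric.tendsto_atTop]
  intro ε hε
  have e1 : ∀ᶠ k in atTop, qNorm m (ψ - ∑ n ∈ Finset.range k, (u (M (n + 1)) - u (M n))) < ε / 2 :=
    ht.eventually (gt_mem_nhds (half_pos hε))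
  have e2 : ∀ᶠ k : ℕ in atTop, (1 / 2 : ℝ) ^ k < ε / 2 :=
    (tendsto_pow_atTop_nhds_zero_of_lt_one (by norm_num) (by norm_num)).eventually
      (gt_mem_nhds (half_pos hε))
  obtain ⟨k, hk1, hk2⟩ := (e1.and e2).exists
  refine ⟨M k, fun n hn => ?_⟩
  rw [Real.dist_eq, sub_zero, abs_of_nonneg (qNorm_nonneg' _ _)]
  have hmem := (h3 k).mem
  have hsum := Finset.sum_range_sub (fun n => u (M n)) k
  have heq : u n - (u (M 0) + ψ) = (u n - u (M k)) +
      (-1 : ℂ) • (ψ - ∑ n ∈ Finset.range k, (u (M (n + 1)) - u (M n))) := by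
    rw [hsum, neg_one_smul ℂ (ψ - (u (M k) - u (M 0)))]; abel
  rw [heq]
  have a1 := qNorm_add_le' hmn ((hu n).sub' hmn (hu (M k))) (hmem.smul' (-1))
  have a2 := qNorm_smul_le' (-1) hmem
  have a3 := hN k n (M k) ((hNM k).trans hn) (hNM k)
  simp only [norm_neg, norm_one, one_mul] at a2
  linarith

theorem introverted' {m : X →L[ℂ] A →L[ℂ] X} (hmn : ∀ (x : X) (a : A), ‖m x a‖ ≤ ‖x‖ * ‖a‖)
    (hma : ∀ (x : X) (a b : A), m (m x a) b = m x (a * b))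
    (μ : (A →L[ℂ] ℂ) → ℂ) (C : ℝ) (hC : 0 ≤ C)
    (hadd : ∀ φ ψ, FqMem m φ → FqMem m ψ → μ (φ + ψ) = μ φ + μ ψ)
    (hsmul : ∀ (c : ℂ) φ, FqMem m φ → μ (c • φ) = c * μ φ)
    (hb : ∀ φ, FqMem m φ → ‖μ φ‖ ≤ C * qNorm m φ)
    {φ : A →L[ℂ] ℂ} {c : ℝ} (h : FRep m φ c) : ∃ ψ : A →L[ℂ] ℂ,
        (∀ a : A, ψ a = μ (dAct φ a)) ∧ FRep m ψ (C * c) := by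
  obtain ⟨xs, x, h1, h2, h3⟩ := h
  have hμb : ∀ f y, ‖μ (coeffFn m f y)‖ ≤ C * ‖f‖ * ‖y‖ := fun f y => by
    rw [mul_assoc]
    refine (hb _ (FRep.single m f y).mem).trans ?_
    gcongr
    exact (FRep.single m f y).qNorm_le
  let L : (X →L[ℂ] ℂ) → (X →L[ℂ] ℂ) := fun f => LinearMap.mkContinuous
    { toFun := fun y => μ (coeffFn m f y)
      map_add' := fun y z => by
        rw [← hadd _ _ (FRep.single m f y).mem (FRep.single m f z).mem]
        congr 1
        ext a
        simp [coeffFn]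
      map_smul' := fun k y => by
        rw [RingHom.id_apply, smul_eq_mul, ← hsmul _ _ (FRep.single m f y).mem]
        congr 1
        ext a
        simp [coeffFn] } (C * ‖f‖) (hμb f)
  have hLv : ∀ f y, L f y = μ (coeffFn m f y) := fun f y => rfl
  have hL : ∀ f, ‖L f‖ ≤ C * ‖f‖ := fun f => LinearMap.mkContinuous_norm_le _ (by positivity) _
  have hle : ∀ n, ‖L (xs n)‖ * ‖x n‖ ≤ C * (‖xs n‖ * ‖x n‖) := fun n => by
    rw [← mul_assoc]; gcongr; exact hL _
  have hs : Summable fun n => ‖L (xs n)‖ * ‖x n‖ :=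
    Summable.of_nonneg_of_le (fun n => by positivity) hle (h1.mul_left C)
  obtain ⟨ψ, -, hψ, -, -⟩ := series_coeff hmn (fun n => L (xs n)) x hs
  refine ⟨ψ, fun a => ?_, fun n => L (xs n), x, hs, hψ, ?_⟩
  · have hsa : Summable fun n => ‖xs n‖ * ‖m (x n) a‖ :=
      Summable.of_nonneg_of_le (fun n => by positivity) (fun n => by
        rw [mul_assoc]; gcongr; exact hmn _ _) (h1.mul_right ‖a‖)
    obtain ⟨θ, t1, t2, t3, -⟩ := series_coeff hmn xs (fun n => m (x n) a) hsa
    have hθ : θ = dAct φ a := by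
      ext b
      refine (t2 b).unique ?_
      simpa [hma, dAct] using h2 (a * b)
    have hfin : ∀ N, FqMem m (∑ n ∈ Finset.range N, coeffFn m (xs n) (m (x n) a)) ∧
        μ (∑ n ∈ Finset.range N, coeffFn m (xs n) (m (x n) a)) =
          ∑ n ∈ Finset.range N, L (xs n) (m (x n) a) := by
      intro N
      induction N with
      | zero =>
        refine ⟨by simpa using (FRep.zero m).mem, ?_⟩
        have h0 := hsmul 0 0 (FRep.zero m).mem
        rw [zero_smul ℂ (0 : A →L[ℂ] ℂ), zero_mul] at h0
        simpa using h0
      | succ N ih =>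
        rw [Finset.sum_range_succ, Finset.sum_range_succ]
        have hm := (FRep.single m (xs N) (m (x N) a)).mem
        exact ⟨ih.1.add' hmn hm, by rw [hadd _ _ ih.1 hm, ih.2, hLv]⟩
    refine tendsto_nhds_unique (hψ a).tendsto_sum_nat ?_
    rw [← hθ, tendsto_iff_norm_sub_tendsto_zero]
    refine squeeze_zero (fun N => norm_nonneg _) (fun N => ?_) (by simpa using t3.const_mul C)
    have hd := t1.sub' hmn (hfin N).1
    have := hadd _ _ hd (hfin N).1
    rw [sub_add_cancel, (hfin N).2] at this
    rw [norm_sub_rev, this, add_sub_cancel_right]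
    exact hb _ hd
  · refine (hs.tsum_le_tsum hle (h1.mul_left C)).trans ?_
    rw [tsum_mul_left]
    gcongr

end helpers


/-- For a contractive right Banach `A`-module `X` (action `m`), the
Fourier space `(F_q(A*), ‖·‖_q)` is a left introverted homogeneous subspace of `A*`:
`F_q(A*)` is a linear subspace of `A*`, `‖·‖_q` is a complete norm on it dominating
`‖·‖_{A*}`, it is a contractive right `A`-module under `φ ↦ φ·a`, and for every bounded
linear functional `μ` on `(F_q(A*), ‖·‖_q)` (given by a function with a bound `C`) the
functional `μ ◻ φ : a ↦ μ(φ·a)` lies in `F_q(A*)` with `‖μ ◻ φ‖_q ≤ C ‖φ‖_q`.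
Moreover every absolutely summable series `Σ xₙ*·xₙ` converges in `‖·‖_q` (hence in
`‖·‖_{A*}`) to the element of `F_q(A*)` given by its `σ(A*,A)`-sum. -/
theorem statement_5
    {A : Type*} [NonUnitalNormedRing A] [NormedSpace ℂ A] [CompleteSpace A]
    [IsScalarTower ℂ A A] [SMulCommClass ℂ A A]
    {X : Type*} [NormedAddCommGroup X] [NormedSpace ℂ X] [CompleteSpace X]
    (m : X →L[ℂ] A →L[ℂ] X)
    (hmn : ∀ (x : X) (a : A), ‖m x a‖ ≤ ‖x‖ * ‖a‖)
    (hma : ∀ (x : X) (a b : A), m (m x a) b = m x (a * b)) :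
    -- linear subspace
    FqMem m 0 ∧
    (∀ φ ψ, FqMem m φ → FqMem m ψ → FqMem m (φ + ψ)) ∧
    (∀ (c : ℂ) φ, FqMem m φ → FqMem m (c • φ)) ∧
    -- `‖·‖_q` is a norm dominating `‖·‖_{A*}`
    (∀ φ, 0 ≤ qNorm m φ) ∧
    (∀ φ ψ, FqMem m φ → FqMem m ψ → qNorm m (φ + ψ) ≤ qNorm m φ + qNorm m ψ) ∧
    (∀ (c : ℂ) φ, FqMem m φ → qNorm m (c • φ) = ‖c‖ * qNorm m φ) ∧
    (∀ φ, FqMem m φ → qNorm m φ = 0 → φ = 0) ∧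
    (∀ φ, FqMem m φ → ‖φ‖ ≤ qNorm m φ) ∧
    -- contractive right `A`-module
    (∀ φ (a : A), FqMem m φ → FqMem m (dAct φ a)) ∧
    (∀ φ (a : A), FqMem m φ → qNorm m (dAct φ a) ≤ qNorm m φ * ‖a‖) ∧
    -- left introverted
    (∀ (μ : (A →L[ℂ] ℂ) → ℂ) (C : ℝ), 0 ≤ C →
      (∀ φ ψ, FqMem m φ → FqMem m ψ → μ (φ + ψ) = μ φ + μ ψ) →
      (∀ (c : ℂ) φ, FqMem m φ → μ (c • φ) = c * μ φ) →
      (∀ φ, FqMem m φ → ‖μ φ‖ ≤ C * qNorm m φ) →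
      ∀ φ, FqMem m φ → ∃ ψ : A →L[ℂ] ℂ, FqMem m ψ ∧
        (∀ a : A, ψ a = μ (dAct φ a)) ∧ qNorm m ψ ≤ C * qNorm m φ) ∧
    -- completeness of `‖·‖_q`
    (∀ u : ℕ → (A →L[ℂ] ℂ), (∀ n, FqMem m (u n)) →
      (∀ ε : ℝ, 0 < ε → ∃ N : ℕ, ∀ k l : ℕ, N ≤ k → N ≤ l → qNorm m (u k - u l) < ε) →
      ∃ φ, FqMem m φ ∧ Tendsto (fun n => qNorm m (u n - φ)) atTop (𝓝 0)) ∧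
    -- absolutely summable series of coefficient functionals
    (∀ (xs : ℕ → (X →L[ℂ] ℂ)) (x : ℕ → X),
      (Summable fun n => ‖xs n‖ * ‖x n‖) →
      ∃ φ : A →L[ℂ] ℂ, FqMem m φ ∧
        (∀ a : A, HasSum (fun n => xs n (m (x n) a)) (φ a)) ∧
        Tendsto (fun N => qNorm m (φ - ∑ n ∈ Finset.range N, coeffFn m (xs n) (x n)))
          atTop (𝓝 0) ∧
        Tendsto (fun N => ‖φ - ∑ n ∈ Finset.range N, coeffFn m (xs n) (x n)‖)
          atTop (𝓝 0)) := by
  have hnorm : ∀ φ, FqMem m φ → ‖φ‖ ≤ qNorm m φ := fun φ h => by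
    simpa using FRep.le_of_forall (k := 1) h fun c hc => by simpa using hc.norm_le hmn
  refine ⟨(FRep.zero m).mem, fun φ ψ h h' => h.add' hmn h', fun c φ h => h.smul' c,
    qNorm_nonneg' m, fun φ ψ h h' => qNorm_add_le' hmn h h', ?_, ?_, hnorm, ?_, ?_, ?_,
    complete' hmn, series_coeff hmn⟩
  · intro c φ h
    refine le_antisymm (qNorm_smul_le' c h) ?_
    rcases eq_or_ne c 0 with rfl | hc
    · simpa using qNorm_nonneg' m _
    · have := qNorm_smul_le' c⁻¹ (h.smul' c)
      rw [inv_smul_smul₀ hc, norm_inv] at this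
      have hp : 0 < ‖c‖ := norm_pos_iff.2 hc
      rwa [inv_mul_eq_div, le_div_iff₀ hp, mul_comm] at this
  · intro φ h h0
    have := hnorm φ h
    rw [h0] at this
    exact norm_le_zero_iff.1 this
  · intro φ a h
    obtain ⟨c, hc⟩ := h.exists_rep
    exact (hc.dAct hmn hma a).mem
  · intro φ a h
    rw [mul_comm]
    exact FRep.le_of_forall h fun c hc => by
      rw [mul_comm]; exact (hc.dAct hmn hma a).qNorm_le
  · intro μ C hC hadd hsmul hb φ h
    obtain ⟨c, hc⟩ := h.exists_rep
    obtain ⟨ψ, h1, h2⟩ := introverted' hmn hma μ C hC hadd hsmul hb hc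
    refine ⟨ψ, h2.mem, h1, FRep.le_of_forall h fun d hd => ?_⟩
    obtain ⟨ψ', h1', h2'⟩ := introverted' hmn hma μ C hC hadd hsmul hb hd
    have : ψ = ψ' := by
      ext a
      rw [h1, h1']
    rw [this]
    exact h2'.qNorm_le


end
end
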